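/- Lemma 4 (connectedness): let f : A ⊢ B be an arrow term of DS, and for i ∈ {1,2} let x_i in A and y_i in B be occurrences of the letter p_i that are linked in f. Then it is impossible that A has a subformula occurrence x₁ ∧ x₂ or x₂ ∧ x₁ and B has a subformula occurrence y₁ ∨ y₂ or y₂ ∨ y₁. -/

import Mathlib

/-! ### The category Br of Brauerian split equivalences of finite ordinals

An arrow `m ⊢ n` of `Br` is represented as a relation on `ℕ ⊕ ℕ`, where
`Sum.inl i` (with `i < m`) is the source copy `i_s` and `Sum.inr j`
(with `j < n`) is the target copy `j_t`. -/

abbrev GRel : Type := (ℕ ⊕ ℕ) → (ℕ ⊕ ℕ) → Prop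

/-- The identity arrow of `Br` on `n`: transversals `{i_s, i_t}` for `i < n`. -/
def gId (n : ℕ) : GRel := fun u v =>
  ∃ i, i < n ∧ (u = Sum.inl i ∨ u = Sum.inr i) ∧ (v = Sum.inl i ∨ v = Sum.inr i)

/-- The Brauerian split equivalence whose transversals are `{i_s, (φ i)_t}` for `i < m`. -/
def gFun (m : ℕ) (φ : ℕ → ℕ) : GRel := fun u v =>
  ∃ i, i < m ∧ (u = Sum.inl i ∨ u = Sum.inr (φ i)) ∧ (v = Sum.inl i ∨ v = Sum.inr (φ i))

/-- The block transposition exchanging the first `a` and the last `b` elements. -/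
def gSwap (a b : ℕ) : GRel :=
  gFun (a + b) (fun i => if i < a then i + b else i - a)

/-- `G Δ̂∧_{B,A}` with `a = GA`, `b = GB`: identity transversals on the stem `A`
together with caps joining the two copies of each letter occurrence of `B` in
the crown `¬B ∨ B` of the target. -/
def gDelta (a b : ℕ) : GRel := fun u v =>
  (∃ i, i < a ∧ (u = Sum.inl i ∨ u = Sum.inr i) ∧ (v = Sum.inl i ∨ v = Sum.inr i)) ∨
  (∃ j, j < b ∧ (u = Sum.inr (a + j) ∨ u = Sum.inr (a + b + j)) ∧
                (v = Sum.inr (a + j) ∨ v = Sum.inr (a + b + j)))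

/-- `G Σ̂∨_{B,A}` with `a = GA`, `b = GB`: identity transversals on the stem `A`
together with cups joining the two copies of each letter occurrence of `B` in
the crown `B ∧ ¬B` of the source. -/
def gSigma (a b : ℕ) : GRel := fun u v =>
  (∃ i, i < a ∧ (u = Sum.inl (2*b + i) ∨ u = Sum.inr i) ∧
                (v = Sum.inl (2*b + i) ∨ v = Sum.inr i)) ∨
  (∃ j, j < b ∧ (u = Sum.inl j ∨ u = Sum.inl (b + j)) ∧
                (v = Sum.inl j ∨ v = Sum.inl (b + j)))

/-- Composition `P ∗ R` in `Br`: glue along the middle copy and take the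
transitive closure, restricted to the outer copies. -/
def gComp (Pr R : GRel) : GRel := fun u v =>
  Relation.TransGen
    (fun x y : ℕ ⊕ ℕ ⊕ ℕ =>
      (∃ x' y', Sum.map id Sum.inl x' = x ∧ Sum.map id Sum.inl y' = y ∧ R x' y') ∨
      (∃ x' y', Sum.inr x' = x ∧ Sum.inr y' = y ∧ Pr x' y'))
    (Sum.map id Sum.inr u) (Sum.map id Sum.inr v)

/-- Shift a split relation by `a` on the source side and by `d` on the target side. -/
def gShift (a d : ℕ) (R : GRel) : GRel := fun u v =>
  ∃ u' v', R u' v' ∧ u = Sum.map (· + a) (· + d) u' ∧ v = Sum.map (· + a) (· + d) v'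

/-- Disjoint union of split relations: `G(f ξ g) = Gf ∪ Gg_{+GD}^{+GA}`. -/
def gPar (a d : ℕ) (R S : GRel) : GRel := fun u v => R u v ∨ gShift a d S u v
/-! ### The language L∧,∨ generated from the set `P` of letters -/

inductive Form (P : Type) : Type
  | letter : P → Form P
  | conj : Form P → Form P → Form P
  | disj : Form P → Form P → Form P

infixr:70 " ⋏ " => Form.conj
infixr:66 " ⋎ " => Form.disj

/-- The number of occurrences of letters in a formula (the object map of `G`). -/
def Form.size {P : Type} : Form P → ℕ
  | .letter _ => 1
  | .conj A B => A.size + B.size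
  | .disj A B => A.size + B.size
/-! ### Arrow terms of the free symmetric net category DS -/

inductive Term (P : Type) : Form P → Form P → Type
  | id (A : Form P) : Term P A A
  | comp {A B C : Form P} : Term P B C → Term P A B → Term P A C
  | conj {A B D E : Form P} : Term P A D → Term P B E → Term P (A ⋏ B) (D ⋏ E)
  | disj {A B D E : Form P} : Term P A D → Term P B E → Term P (A ⋎ B) (D ⋎ E)
  | bConjTo (A B C : Form P) : Term P (A ⋏ (B ⋏ C)) ((A ⋏ B) ⋏ C)
  | bConjFrom (A B C : Form P) : Term P ((A ⋏ B) ⋏ C) (A ⋏ (B ⋏ C))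
  | bDisjTo (A B C : Form P) : Term P (A ⋎ (B ⋎ C)) ((A ⋎ B) ⋎ C)
  | bDisjFrom (A B C : Form P) : Term P ((A ⋎ B) ⋎ C) (A ⋎ (B ⋎ C))
  | cConj (A B : Form P) : Term P (A ⋏ B) (B ⋏ A)
  | cDisj (A B : Form P) : Term P (B ⋎ A) (A ⋎ B)
  | d (A B C : Form P) : Term P (A ⋏ (B ⋎ C)) ((A ⋏ B) ⋎ C)

infixr:80 " ⬝ " => Term.comp
infixr:70 " ⊼ " => Term.conj
infixr:66 " ⊽ " => Term.disj

/-- The arrow `d^R_{C,B,A} : (C∨B)∧A ⊢ C∨(B∧A)`. -/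
def dR {P : Type} (C B A : Form P) : Term P ((C ⋎ B) ⋏ A) (C ⋎ (B ⋏ A)) :=
  Term.cDisj C (B ⋏ A) ⬝ ((Term.cConj A B ⊽ Term.id C) ⬝
    (Term.d A B C ⬝ ((Term.id A ⊼ Term.cDisj B C) ⬝ Term.cConj (C ⋎ B) A)))
/-! ### The equations of DS, imposed on arrow terms -/

inductive Eqv {P : Type} : ∀ {A B : Form P}, Term P A B → Term P A B → Prop
  -- equivalence and congruence
  | refl {A B : Form P} (f : Term P A B) : Eqv f f
  | symm {A B : Form P} {f g : Term P A B} : Eqv f g → Eqv g f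
  | trans {A B : Form P} {f g h : Term P A B} : Eqv f g → Eqv g h → Eqv f h
  | congComp {A B C : Form P} {g g' : Term P B C} {f f' : Term P A B} :
      Eqv g g' → Eqv f f' → Eqv (g ⬝ f) (g' ⬝ f')
  | congConj {A B D E : Form P} {f f' : Term P A D} {g g' : Term P B E} :
      Eqv f f' → Eqv g g' → Eqv (f ⊼ g) (f' ⊼ g')
  | congDisj {A B D E : Form P} {f f' : Term P A D} {g g' : Term P B E} :
      Eqv f f' → Eqv g g' → Eqv (f ⊽ g) (f' ⊽ g')
  -- (cat 1), (cat 2)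
  | catIdR {A B : Form P} (f : Term P A B) : Eqv (f ⬝ Term.id A) f
  | catIdL {A B : Form P} (f : Term P A B) : Eqv (Term.id B ⬝ f) f
  | catAssoc {A B C D : Form P} (f : Term P A B) (g : Term P B C) (h : Term P C D) :
      Eqv (h ⬝ (g ⬝ f)) ((h ⬝ g) ⬝ f)
  -- bifunctorial equations (ξ 1), (ξ 2)
  | conjOne (A B : Form P) : Eqv (Term.id A ⊼ Term.id B) (Term.id (A ⋏ B))
  | disjOne (A B : Form P) : Eqv (Term.id A ⊽ Term.id B) (Term.id (A ⋎ B))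
  | conjTwo {A₁ B₁ C₁ A₂ B₂ C₂ : Form P} (g₁ : Term P B₁ C₁) (f₁ : Term P A₁ B₁)
      (g₂ : Term P B₂ C₂) (f₂ : Term P A₂ B₂) :
      Eqv ((g₁ ⬝ f₁) ⊼ (g₂ ⬝ f₂)) ((g₁ ⊼ g₂) ⬝ (f₁ ⊼ f₂))
  | disjTwo {A₁ B₁ C₁ A₂ B₂ C₂ : Form P} (g₁ : Term P B₁ C₁) (f₁ : Term P A₁ B₁)
      (g₂ : Term P B₂ C₂) (f₂ : Term P A₂ B₂) :
      Eqv ((g₁ ⬝ f₁) ⊽ (g₂ ⬝ f₂)) ((g₁ ⊽ g₂) ⬝ (f₁ ⊽ f₂))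
  -- naturality equations
  | bConjNat {A B C D E F : Form P} (f : Term P A D) (g : Term P B E) (h : Term P C F) :
      Eqv (((f ⊼ g) ⊼ h) ⬝ Term.bConjTo A B C) (Term.bConjTo D E F ⬝ (f ⊼ (g ⊼ h)))
  | bDisjNat {A B C D E F : Form P} (f : Term P A D) (g : Term P B E) (h : Term P C F) :
      Eqv (((f ⊽ g) ⊽ h) ⬝ Term.bDisjTo A B C) (Term.bDisjTo D E F ⬝ (f ⊽ (g ⊽ h)))
  | cConjNat {A B D E : Form P} (f : Term P A D) (g : Term P B E) :
      Eqv ((g ⊼ f) ⬝ Term.cConj A B) (Term.cConj D E ⬝ (f ⊼ g))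
  | cDisjNat {A B D E : Form P} (f : Term P A D) (g : Term P B E) :
      Eqv ((g ⊽ f) ⬝ Term.cDisj B A) (Term.cDisj E D ⬝ (f ⊽ g))
  | dNat {A B C D E F : Form P} (f : Term P A D) (g : Term P B E) (h : Term P C F) :
      Eqv (((f ⊼ g) ⊽ h) ⬝ Term.d A B C) (Term.d D E F ⬝ (f ⊼ (g ⊽ h)))
  -- (b̂ξ b̂ξ)
  | bConjIso₁ (A B C : Form P) :
      Eqv (Term.bConjFrom A B C ⬝ Term.bConjTo A B C) (Term.id (A ⋏ (B ⋏ C)))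
  | bConjIso₂ (A B C : Form P) :
      Eqv (Term.bConjTo A B C ⬝ Term.bConjFrom A B C) (Term.id ((A ⋏ B) ⋏ C))
  | bDisjIso₁ (A B C : Form P) :
      Eqv (Term.bDisjFrom A B C ⬝ Term.bDisjTo A B C) (Term.id (A ⋎ (B ⋎ C)))
  | bDisjIso₂ (A B C : Form P) :
      Eqv (Term.bDisjTo A B C ⬝ Term.bDisjFrom A B C) (Term.id ((A ⋎ B) ⋎ C))
  -- (b̂ξ 5)
  | bConjPent (A B C D : Form P) :
      Eqv (Term.bConjFrom A B (C ⋏ D) ⬝ Term.bConjFrom (A ⋏ B) C D)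
        ((Term.id A ⊼ Term.bConjFrom B C D) ⬝
          (Term.bConjFrom A (B ⋏ C) D ⬝ (Term.bConjFrom A B C ⊼ Term.id D)))
  | bDisjPent (A B C D : Form P) :
      Eqv (Term.bDisjFrom A B (C ⋎ D) ⬝ Term.bDisjFrom (A ⋎ B) C D)
        ((Term.id A ⊽ Term.bDisjFrom B C D) ⬝
          (Term.bDisjFrom A (B ⋎ C) D ⬝ (Term.bDisjFrom A B C ⊽ Term.id D)))
  -- (ĉ∧ ĉ∧), (ĉ∨ ĉ∨)
  | cConjIso (A B : Form P) : Eqv (Term.cConj B A ⬝ Term.cConj A B) (Term.id (A ⋏ B))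
  | cDisjIso (A B : Form P) : Eqv (Term.cDisj A B ⬝ Term.cDisj B A) (Term.id (A ⋎ B))
  -- (b̂∧ ĉ∧), (b̂∨ ĉ∨)
  | bcConj (A B C : Form P) :
      Eqv ((Term.id B ⊼ Term.cConj C A) ⬝ (Term.bConjFrom B C A ⬝
            (Term.cConj A (B ⋏ C) ⬝ (Term.bConjFrom A B C ⬝ (Term.cConj B A ⊼ Term.id C)))))
        (Term.bConjFrom B A C)
  | bcDisj (A B C : Form P) :
      Eqv ((Term.id B ⊽ Term.cDisj A C) ⬝ (Term.bDisjFrom B C A ⬝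
            (Term.cDisj (B ⋎ C) A ⬝ (Term.bDisjFrom A B C ⬝ (Term.cDisj A B ⊽ Term.id C)))))
        (Term.bDisjFrom B A C)
  -- (d ∧), (d ∨)
  | dConj (A B C D : Form P) :
      Eqv ((Term.bConjFrom A B C ⊽ Term.id D) ⬝ Term.d (A ⋏ B) C D)
        (Term.d A (B ⋏ C) D ⬝ ((Term.id A ⊼ Term.d B C D) ⬝ Term.bConjFrom A B (C ⋎ D)))
  | dDisj (D C B A : Form P) :
      Eqv (Term.d D C (B ⋎ A) ⬝ (Term.id D ⊼ Term.bDisjFrom C B A))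
        (Term.bDisjFrom (D ⋏ C) B A ⬝ ((Term.d D C B ⊽ Term.id A) ⬝ Term.d D (C ⋎ B) A))
  -- (d b̂∧), (d b̂∨)
  | dBConj (A B C D : Form P) :
      Eqv (dR (A ⋏ B) C D ⬝ (Term.d A B C ⊼ Term.id D))
        (Term.d A B (C ⋏ D) ⬝ ((Term.id A ⊼ dR B C D) ⬝ Term.bConjFrom A (B ⋎ C) D))
  | dBDisj (D C B A : Form P) :
      Eqv ((Term.id D ⊽ Term.d C B A) ⬝ dR D C (B ⋎ A))
        (Term.bDisjFrom D (C ⋏ B) A ⬝ ((dR D C B ⊽ Term.id A) ⬝ Term.d (D ⋎ C) B A))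
/-- The functor `G` from DS to Br on arrow terms. -/
def Term.G {P : Type} : ∀ {A B : Form P}, Term P A B → GRel
  | _, _, .id A => gId A.size
  | _, _, .comp g f => gComp (Term.G g) (Term.G f)
  | _, _, @Term.conj _ A _ D _ f g => gPar A.size D.size (Term.G f) (Term.G g)
  | _, _, @Term.disj _ A _ D _ f g => gPar A.size D.size (Term.G f) (Term.G g)
  | _, _, .bConjTo A B C => gId (A.size + (B.size + C.size))
  | _, _, .bConjFrom A B C => gId (A.size + B.size + C.size)
  | _, _, .bDisjTo A B C => gId (A.size + (B.size + C.size))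
  | _, _, .bDisjFrom A B C => gId (A.size + B.size + C.size)
  | _, _, .cConj A B => gSwap A.size B.size
  | _, _, .cDisj A B => gSwap B.size A.size
  | _, _, .d A B C => gId (A.size + (B.size + C.size))
/-! ### Occurrences of letters and subformula occurrences -/

/-- The letter at the `(n+1)`-th letter-occurrence position of a formula
(`n` counted from `0`, from the left). -/
def Form.letterAt {P : Type} : Form P → ℕ → Option P
  | .letter p, 0 => some p
  | .letter _, _ + 1 => none
  | .conj A B, n => if n < A.size then A.letterAt n else B.letterAt (n - A.size)
  | .disj A B, n => if n < A.size then A.letterAt n else B.letterAt (n - A.size)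

/-- Directions for addressing subformula occurrences. -/
inductive Dir : Type
  | l
  | r
deriving DecidableEq

/-- The subformula occurrence of a formula at a given position (path). -/
def Form.subAt {P : Type} : Form P → List Dir → Option (Form P)
  | A, [] => some A
  | .conj A _, .l :: π => A.subAt π
  | .conj _ B, .r :: π => B.subAt π
  | .disj A _, .l :: π => A.subAt π
  | .disj _ B, .r :: π => B.subAt π
  | .letter _, _ :: _ => none

/-- The number of letter occurrences strictly to the left of the subformula
occurrence at a given position. -/
def Form.offsetAt {P : Type} : Form P → List Dir → ℕ
  | _, [] => 0
  | .conj A _, .l :: π => A.offsetAt π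
  | .conj A B, .r :: π => A.size + B.offsetAt π
  | .disj A _, .l :: π => A.offsetAt π
  | .disj A B, .r :: π => A.size + B.offsetAt π
  | .letter _, _ :: _ => 0

/-- The `(n+1)`-th occurrence of a letter in `A` is *linked* in `f : A ⊢ B` to the
`(m+1)`-th occurrence of the same letter in `B` when `{n_s, m_t}` is a member of
the partition corresponding to `Gf`. -/
def Linked {P : Type} {A B : Form P} (f : Term P A B) (n m : ℕ) : Prop :=
  Term.G f (Sum.inl n) (Sum.inr m)

/-- Is the immediate connective above the `n`-th letter occurrence a conjunction?
`c` is the answer for a formula that is a single letter. -/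
def Form.par {P : Type} : Form P → Bool → ℕ → Bool
  | .letter _, c, _ => c
  | .conj A B, _, n => if n < A.size then A.par true n else B.par true (n - A.size)
  | .disj A B, _, n => if n < A.size then A.par false n else B.par false (n - A.size)

theorem par_mono {P : Type} (A : Form P) (c : Bool) (n : ℕ) (h : A.par c n = true) :
    A.par true n = true := by
  cases A <;> simp_all [Form.par]

/-- `R` is contained in the split equivalence of a permutation `φ` of `n`. -/
structure Good (n : ℕ) (R : GRel) (φ ψ : ℕ → ℕ) : Prop where
  lt : ∀ i, i < n → φ i < n
  lt' : ∀ i, i < n → ψ i < n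
  inv : ∀ i, i < n → ψ (φ i) = i
  inv' : ∀ i, i < n → φ (ψ i) = i
  le : ∀ u v, R u v → gFun n φ u v

theorem good_id (n : ℕ) : Good n (gId n) (fun i => i) (fun i => i) :=
  ⟨fun _ h => h, fun _ h => h, fun _ _ => rfl, fun _ _ => rfl, fun _ _ h => h⟩

theorem good_swap (a b : ℕ) : Good (a + b) (gSwap a b)
    (fun i => if i < a then i + b else i - a) (fun i => if i < b then i + a else i - b) := by
  refine ⟨?_, ?_, ?_, ?_, fun _ _ h => h⟩ <;> intro i hi <;> grind

theorem good_comp {n : ℕ} {R S : GRel} {φ φ' ψ ψ' : ℕ → ℕ} (hR : Good n R φ φ')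
    (hS : Good n S ψ ψ') : Good n (gComp S R) (fun i => ψ (φ i)) (fun i => φ' (ψ' i)) := by
  have h1 := hR.lt
  have h2 := hR.lt'
  have h3 := hR.inv
  have h4 := hR.inv'
  have k1 := hS.lt
  have k2 := hS.lt'
  have k3 := hS.inv
  have k4 := hS.inv'
  refine ⟨by grind, by grind, by grind, by grind, ?_⟩
  intro u v h
  let cls : ℕ → ℕ ⊕ ℕ ⊕ ℕ → Prop := fun i x =>
    x = Sum.inl i ∨ x = Sum.inr (Sum.inl (φ i)) ∨ x = Sum.inr (Sum.inr (ψ (φ i)))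
  have uniq : ∀ i j x, i < n → j < n → cls i x → cls j x → i = j := by
    intro i j x hi hj hx hy
    have a1 := h3 i hi
    have a2 := h3 j hj
    have a3 := k3 _ (h1 i hi)
    have a4 := k3 _ (h1 j hj)
    rcases hx with rfl | rfl | rfl <;> rcases hy with e | e | e <;> simp at e <;> grind
  have step : ∀ x y : ℕ ⊕ ℕ ⊕ ℕ,
      ((∃ x' y', Sum.map id Sum.inl x' = x ∧ Sum.map id Sum.inl y' = y ∧ R x' y') ∨
      (∃ x' y', Sum.inr x' = x ∧ Sum.inr y' = y ∧ S x' y')) →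
      ∃ i, i < n ∧ cls i x ∧ cls i y := by
    rintro x y (⟨x', y', rfl, rfl, hr⟩ | ⟨x', y', rfl, rfl, hr⟩)
    · obtain ⟨i, hi, hx, hy⟩ := hR.le _ _ hr
      refine ⟨i, hi, ?_, ?_⟩
      · rcases hx with rfl | rfl <;> simp [cls]
      · rcases hy with rfl | rfl <;> simp [cls]
    · obtain ⟨i, hi, hx, hy⟩ := hS.le _ _ hr
      refine ⟨φ' i, h2 i hi, ?_, ?_⟩
      · rcases hx with rfl | rfl <;> simp [cls, h4 i hi]
      · rcases hy with rfl | rfl <;> simp [cls, h4 i hi]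
  have key : ∃ i, i < n ∧ cls i (Sum.map id Sum.inr u) ∧ cls i (Sum.map id Sum.inr v) := by
    unfold gComp at h
    generalize Sum.map id Sum.inr u = x at h ⊢
    generalize Sum.map id Sum.inr v = y at h ⊢
    induction h with
    | single h => exact step _ _ h
    | tail _ h ih =>
      obtain ⟨i, hi, a, b⟩ := ih
      obtain ⟨j, hj, c, d⟩ := step _ _ h
      have := uniq i j _ hi hj b c
      subst this
      exact ⟨i, hi, a, d⟩
  obtain ⟨i, hi, a, b⟩ := key
  refine ⟨i, hi, ?_, ?_⟩
  · rcases u with u | u <;> simpa [cls] using a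
  · rcases v with v | v <;> simpa [cls] using b

theorem good_par {a b : ℕ} {R S : GRel} {φ φ' ψ ψ' : ℕ → ℕ} (hR : Good a R φ φ')
    (hS : Good b S ψ ψ') : Good (a + b) (gPar a a R S)
      (fun i => if i < a then φ i else ψ (i - a) + a)
      (fun i => if i < a then φ' i else ψ' (i - a) + a) := by
  have h1 := hR.lt
  have h2 := hR.lt'
  have h3 := hR.inv
  have h4 := hR.inv'
  have k1 := hS.lt
  have k2 := hS.lt'
  have k3 := hS.inv
  have k4 := hS.inv'
  refine ⟨?_, ?_, ?_, ?_, ?_⟩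
  · intro i hi
    by_cases h : i < a
    · have := h1 i h
      simp only [h, if_true]; omega
    · have := k1 (i - a) (by omega)
      simp only [h, if_false]; omega
  · intro i hi
    by_cases h : i < a
    · have := h2 i h
      simp only [h, if_true]; omega
    · have := k2 (i - a) (by omega)
      simp only [h, if_false]; omega
  · intro i hi
    by_cases h : i < a
    · simp [h, h1 i h, h3 i h]
    · have := k3 (i - a) (by omega)
      simp [h, this]; omega
  · intro i hi
    by_cases h : i < a
    · simp [h, h2 i h, h4 i h]
    · have := k4 (i - a) (by omega)
      simp [h, this]; omega
  · rintro u v (h | ⟨u', v', h, rfl, rfl⟩)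
    · obtain ⟨i, hi, hu, hv⟩ := hR.le _ _ h
      refine ⟨i, by omega, ?_, ?_⟩
      · simpa [hi] using hu
      · simpa [hi] using hv
    · obtain ⟨i, hi, hu, hv⟩ := hS.le _ _ h
      refine ⟨i + a, by omega, ?_, ?_⟩
      · rcases hu with rfl | rfl <;> simp
      · rcases hv with rfl | rfl <;> simp

theorem main_inv {P : Type} {A B : Form P} (f : Term P A B) :
    A.size = B.size ∧ ∃ φ ψ, Good A.size (Term.G f) φ ψ ∧
      ∀ c i, i < A.size → A.par c i = true → B.par c (φ i) = true := by
  induction f with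
  | id A => exact ⟨rfl, _, _, good_id _, fun _ _ _ h => h⟩
  | comp g f ihg ihf =>
    obtain ⟨e1, φ, φ', h1, p1⟩ := ihf
    obtain ⟨e2, ψ, ψ', h2, p2⟩ := ihg
    rw [← e1] at h2 p2
    exact ⟨e1.trans e2, _, _, good_comp h1 h2,
      fun c i hi h => p2 c _ (h1.lt i hi) (p1 c i hi h)⟩
  | conj f g ihf ihg =>
    obtain ⟨e1, φ, φ', h1, p1⟩ := ihf
    obtain ⟨e2, ψ, ψ', h2, p2⟩ := ihg
    refine ⟨by simp [Form.size, e1, e2], _, _, by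
      simpa only [Form.size, Term.G, ← e1] using good_par h1 h2, ?_⟩
    intro c i hi h
    simp only [Form.size, Form.par, ← e1] at hi h ⊢
    split_ifs at h ⊢ with h3 h4 h4
    · exact p1 _ _ h3 h
    · exact absurd (h1.lt i h3) h4
    · omega
    · simpa using p2 _ _ (by omega) h
  | disj f g ihf ihg =>
    obtain ⟨e1, φ, φ', h1, p1⟩ := ihf
    obtain ⟨e2, ψ, ψ', h2, p2⟩ := ihg
    refine ⟨by simp [Form.size, e1, e2], _, _, by
      simpa only [Form.size, Term.G, ← e1] using good_par h1 h2, ?_⟩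
    intro c i hi h
    simp only [Form.size, Form.par, ← e1] at hi h ⊢
    split_ifs at h ⊢ with h3 h4 h4
    · exact p1 _ _ h3 h
    · exact absurd (h1.lt i h3) h4
    · omega
    · simpa using p2 _ _ (by omega) h
  | bConjTo A B C =>
    refine ⟨by simp [Form.size]; omega, _, _, good_id _, fun c i hi h => ?_⟩
    simp only [Form.size, Form.par] at hi h ⊢
    grind
  | bConjFrom A B C =>
    refine ⟨by simp [Form.size]; omega, _, _, good_id _, fun c i hi h => ?_⟩
    simp only [Form.size, Form.par] at hi h ⊢
    grind
  | bDisjTo A B C =>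
    refine ⟨by simp [Form.size]; omega, _, _, good_id _, fun c i hi h => ?_⟩
    simp only [Form.size, Form.par] at hi h ⊢
    grind
  | bDisjFrom A B C =>
    refine ⟨by simp [Form.size]; omega, _, _, good_id _, fun c i hi h => ?_⟩
    simp only [Form.size, Form.par] at hi h ⊢
    grind
  | cConj A B =>
    refine ⟨by simp [Form.size]; omega, _, _, good_swap _ _, fun c i hi h => ?_⟩
    simp only [Form.size, Form.par] at hi h ⊢
    grind
  | cDisj A B =>
    refine ⟨by simp [Form.size]; omega, _, _, good_swap _ _, fun c i hi h => ?_⟩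
    simp only [Form.size, Form.par] at hi h ⊢
    grind
  | d A B C =>
    refine ⟨by simp [Form.size]; omega, _, _, good_id _, fun c i hi h => ?_⟩
    have hm := par_mono B false (i - A.size)
    simp only [Form.size, Form.par] at hi h ⊢
    grind

theorem sub_par {P : Type} (S : Form P) (k : ℕ) (hk : k < S.size) (A : Form P) :
    ∀ (π : List Dir) (c : Bool), A.subAt π = some S →
      A.offsetAt π + k < A.size ∧ ∃ c', A.par c (A.offsetAt π + k) = S.par c' k := by
  induction A with
  | letter p =>
    intro π c h
    cases π with
    | nil =>
      simp only [Form.subAt, Option.some.injEq] at h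
      subst h
      exact ⟨by simpa [Form.offsetAt] using hk, c, by simp [Form.offsetAt]⟩
    | cons d π => simp [Form.subAt] at h
  | conj A B ihA ihB =>
    intro π c h
    match π with
    | [] =>
      simp only [Form.subAt, Option.some.injEq] at h
      subst h
      exact ⟨by simpa [Form.offsetAt] using hk, c, by simp [Form.offsetAt]⟩
    | .l :: π =>
      obtain ⟨h1, c', h2⟩ := ihA π true h
      simp only [Form.offsetAt, Form.size, Form.par, h1, if_true]
      exact ⟨by omega, c', h2⟩
    | .r :: π =>
      obtain ⟨h1, c', h2⟩ := ihB π true h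
      have e : A.size + B.offsetAt π + k - A.size = B.offsetAt π + k := by omega
      have e' : ¬ A.size + B.offsetAt π + k < A.size := by omega
      refine ⟨by simp only [Form.offsetAt, Form.size]; omega, c', ?_⟩
      rw [← h2]
      simp only [Form.offsetAt]
      simp only [Form.par, e', if_false, e]
  | disj A B ihA ihB =>
    intro π c h
    match π with
    | [] =>
      simp only [Form.subAt, Option.some.injEq] at h
      subst h
      exact ⟨by simpa [Form.offsetAt] using hk, c, by simp [Form.offsetAt]⟩
    | .l :: π =>
      obtain ⟨h1, c', h2⟩ := ihA π false h
      simp only [Form.offsetAt, Form.size, Form.par, h1, if_true]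
      exact ⟨by omega, c', h2⟩
    | .r :: π =>
      obtain ⟨h1, c', h2⟩ := ihB π false h
      have e : A.size + B.offsetAt π + k - A.size = B.offsetAt π + k := by omega
      have e' : ¬ A.size + B.offsetAt π + k < A.size := by omega
      refine ⟨by simp only [Form.offsetAt, Form.size]; omega, c', ?_⟩
      rw [← h2]
      simp only [Form.offsetAt]
      simp only [Form.par, e', if_false, e]

theorem off_append {P : Type} (S : Form P) (ρ : List Dir) (A : Form P) :
    ∀ π : List Dir, A.subAt π = some S →
      A.offsetAt (π ++ ρ) = A.offsetAt π + S.offsetAt ρ := by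
  induction A with
  | letter p =>
    intro π h
    cases π with
    | nil => simp only [Form.subAt, Option.some.injEq] at h; subst h; simp [Form.offsetAt]
    | cons d π => simp [Form.subAt] at h
  | conj A B ihA ihB =>
    intro π h
    match π with
    | [] => simp only [Form.subAt, Option.some.injEq] at h; subst h; simp [Form.offsetAt]
    | .l :: π => exact ihA π h
    | .r :: π =>
      have := ihB π h
      simp only [List.cons_append, Form.offsetAt]; omega
  | disj A B ihA ihB =>
    intro π h
    match π with
    | [] => simp only [Form.subAt, Option.some.injEq] at h; subst h; simp [Form.offsetAt]
    | .l :: π => exact ihA π h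
    | .r :: π =>
      have := ihB π h
      simp only [List.cons_append, Form.offsetAt]; omega

theorem conj_leaf {P : Type} {A : Form P} {π : List Dir} {p q : P} (d : Dir)
    (h : A.subAt π = some (Form.letter p ⋏ Form.letter q)) :
    A.par true (A.offsetAt (π ++ [d])) = true := by
  rw [off_append _ _ _ _ h]
  obtain ⟨_, c', h2⟩ := sub_par _ ((Form.letter p ⋏ Form.letter q).offsetAt [d])
    (by cases d <;> simp [Form.offsetAt, Form.size]) A π true h
  rw [h2]
  cases d <;> simp [Form.offsetAt, Form.par, Form.size]

theorem disj_leaf {P : Type} {A : Form P} {π : List Dir} {p q : P} (d : Dir)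
    (h : A.subAt π = some (Form.letter p ⋎ Form.letter q)) :
    A.par true (A.offsetAt (π ++ [d])) = false := by
  rw [off_append _ _ _ _ h]
  obtain ⟨_, c', h2⟩ := sub_par _ ((Form.letter p ⋎ Form.letter q).offsetAt [d])
    (by cases d <;> simp [Form.offsetAt, Form.size]) A π true h
  rw [h2]
  cases d <;> simp [Form.offsetAt, Form.par, Form.size]

/-- **Lemma 4** (connectedness): let `f : A ⊢ B` be an arrow term of DS, and for
`i ∈ {1,2}` let `x_i` in `A` and `y_i` in `B` be occurrences of the letter `p_i`
that are linked in `f`. Then it is impossible that `A` has a subformula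
occurrence `x₁ ∧ x₂` or `x₂ ∧ x₁` and `B` has a subformula occurrence `y₁ ∨ y₂`
or `y₂ ∨ y₁`. -/
theorem lemma_4 {P : Type} {A B : Form P} (f : Term P A B) (p₁ p₂ : P)
    (π₁ π₂ ρ₁ ρ₂ : List Dir)
    (hx₁ : A.subAt π₁ = some (Form.letter p₁)) (hx₂ : A.subAt π₂ = some (Form.letter p₂))
    (hy₁ : B.subAt ρ₁ = some (Form.letter p₁)) (hy₂ : B.subAt ρ₂ = some (Form.letter p₂))
    (hl₁ : Linked f (A.offsetAt π₁) (B.offsetAt ρ₁))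
    (hl₂ : Linked f (A.offsetAt π₂) (B.offsetAt ρ₂))
    (hA : ∃ π : List Dir,
      (A.subAt π = some (Form.letter p₁ ⋏ Form.letter p₂) ∧
        π₁ = π ++ [Dir.l] ∧ π₂ = π ++ [Dir.r]) ∨
      (A.subAt π = some (Form.letter p₂ ⋏ Form.letter p₁) ∧
        π₂ = π ++ [Dir.l] ∧ π₁ = π ++ [Dir.r]))
    (hB : ∃ ρ : List Dir,
      (B.subAt ρ = some (Form.letter p₁ ⋎ Form.letter p₂) ∧
        ρ₁ = ρ ++ [Dir.l] ∧ ρ₂ = ρ ++ [Dir.r]) ∨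
      (B.subAt ρ = some (Form.letter p₂ ⋎ Form.letter p₁) ∧
        ρ₂ = ρ ++ [Dir.l] ∧ ρ₁ = ρ ++ [Dir.r])) :
    False := by
  have ha : A.par true (A.offsetAt π₁) = true := by
    obtain ⟨π, ⟨h, rfl, -⟩ | ⟨h, -, rfl⟩⟩ := hA <;> exact conj_leaf _ h
  have hb : B.par true (B.offsetAt ρ₁) = false := by
    obtain ⟨ρ, ⟨h, rfl, -⟩ | ⟨h, -, rfl⟩⟩ := hB <;> exact disj_leaf _ h
  obtain ⟨-, φ, ψ, hg, hp⟩ := main_inv f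
  obtain ⟨i, hi, hu, hv⟩ := hg.le _ _ hl₁
  simp only [Sum.inl.injEq, reduceCtorEq, or_false, false_or, Sum.inr.injEq] at hu hv
  subst hu
  have := hp true _ hi ha
  rw [← hv, hb] at this
  exact Bool.noConfusion this
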